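/- For every M ≥ 2 and α_0 > 0, if k = 5 there exist constants c_0 > 0, b > 0 and 0 < δ < 1/k such that, for Λ̃ = Λ(e_1) and parameters λ_n = α_0 M^n (fidelity exponent α = 2, regularization exponent β = 1, regularization R(w) = ‖w‖_{BV(ℝ)}), the multiscale sequence {σ_n}_{n≥0} coincides with the explicit sequence σ_n = Σ_{j=0}^n u_j where u_j = (b/√(j+2)) e_{j+2}; in particular ‖σ_n‖_{L²(ℝ)} → +∞, ‖σ_n‖_{L¹(ℝ)} → +∞ and ‖σ_n‖_{BV(ℝ)} = b(n+1) → +∞. -/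

import Mathlib

open Filter MeasureTheory
open scoped ENNReal Topology

noncomputable section

def Acoef (k : ℕ) (δ : ℝ) (i : ℕ) : ℝ :=
  if i = 1 then 1 - k * δ else if i = k then 2 * δ else δ

def Ccoef (k : ℕ) (δ : ℝ) (m : ℕ) : ℝ := ∑ i ∈ Finset.Icc 1 m, Acoef k δ i

def eta (c0 M : ℝ) (j : ℕ) : ℝ := Real.sqrt (c0 / M ^ j)

def mu (c0 M δ : ℝ) (j : ℕ) : ℝ := -δ * eta c0 M j

/-- Left endpoints of the intervals `I_j`:  `a_1 = 0`, `b_j = a_j + 4/j`,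
`a_{j+1} = b_j + j²` (the Lean index `j` corresponds to the paper index `j + 1`). -/
def aseq (j : ℕ) : ℝ := ∑ i ∈ Finset.range j, (4 / ((i : ℝ) + 1) + ((i : ℝ) + 1) ^ 2)

/-- Right endpoints of the intervals `I_j`. -/
def bseq (j : ℕ) : ℝ := aseq j + 4 / ((j : ℝ) + 1)

/-- `e_j = (−1)^j (√j/2) χ_{I_j}` (paper index `j` is the Lean index `j − 1`),
an orthonormal system in `L²(ℝ)`. -/
def ef (j : ℕ) : Lp ℝ 2 (volume : Measure ℝ) :=
  ((-1 : ℝ) ^ (j + 1) * (Real.sqrt ((j : ℝ) + 1) / 2)) •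
    indicatorConstLp 2 (measurableSet_Icc (a := aseq j) (b := bseq j))
      (by rw [Real.volume_Icc]; exact ENNReal.ofReal_ne_top) (1 : ℝ)

/-- `χ_{L_j}` with `L_j = (b_j, a_{j+1})`. -/
def chiL (j : ℕ) : Lp ℝ 2 (volume : Measure ℝ) :=
  indicatorConstLp 2 (measurableSet_Ioo (a := bseq j) (b := aseq (j + 1)))
    (by rw [Real.volume_Ioo]; exact ENNReal.ofReal_ne_top) (1 : ℝ)

/-- `H̃`, the closure of the span of the `e_j`. -/
def Htilde : Submodule ℝ (Lp ℝ 2 (volume : Measure ℝ)) :=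
  (Submodule.span ℝ (Set.range ef)).topologicalClosure

/-- `K = { v ∈ L²(ℝ) : v = ∑_j κ_j χ_{L_j}` for some `κ ∈ ℓ^∞ }`. -/
def Kset : Set (Lp ℝ 2 (volume : Measure ℝ)) :=
  {v | ∃ κ : ℕ → ℝ, (∃ C : ℝ, ∀ j, |κ j| ≤ C) ∧ HasSum (fun j => κ j • chiL j) v}

/-- `P = (H̃ + K)^⊥`. -/
def Pspace : Submodule ℝ (Lp ℝ 2 (volume : Measure ℝ)) :=
  (Htilde ⊔ Submodule.span ℝ Kset)ᗮ

/-- The defining properties of the blurring operator `Λ : L²(ℝ) → L²(ℝ)`: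
on the orthonormal system `{e_j}` it acts by the prescribed combinations, and it is the
identity on `K` and on `P`. -/
def LamSpec (c0 M δ b : ℝ) (k : ℕ)
    (Λ : Lp ℝ 2 (volume : Measure ℝ) →L[ℝ] Lp ℝ 2 (volume : Measure ℝ)) : Prop :=
  (Λ (ef 0) =
      (∑ m ∈ Finset.Icc 1 k, (Ccoef k δ m * eta c0 M m) • ef (m - 1)) +
      (∑' m : ℕ, if k ≤ m then eta c0 M (m + 1) • ef m else 0) +
      (mu c0 M δ k) • ef (k - 1)) ∧
  (∀ j : ℕ, 1 ≤ j →
    Λ (ef j) = (Real.sqrt ((j : ℝ) + 1) / b) •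
      ((∑ i ∈ Finset.Icc 1 k, (Acoef k δ i * eta c0 M (j + i - 1)) • ef (j + i - 2)) +
        (mu c0 M δ (j + k - 1)) • ef (j + k - 2) -
        (mu c0 M δ (j + k)) • ef (j + k - 1))) ∧
  (∀ v ∈ Kset, Λ v = v) ∧
  (∀ z ∈ Pspace, Λ z = z)

/-- The homogeneous `BV` norm of (the equivalence class) `w ∈ L²(ℝ)`: the infimum of the
total variations of the representatives of `w` (`+∞` if `w` has no `BV` representative). -/
def BVnorm (w : Lp ℝ 2 (volume : Measure ℝ)) : ℝ≥0∞ :=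
  sInf ((fun g : ℝ → ℝ => eVariationOn g Set.univ) '' {g : ℝ → ℝ | g =ᵐ[volume] ⇑w})

/-- `u_j = (b/√(j+2)) e_{j+2}` (paper index `j+2` is the Lean index `j+1`). -/
def uL (b : ℝ) (j : ℕ) : Lp ℝ 2 (volume : Measure ℝ) :=
  (b / Real.sqrt ((j : ℝ) + 2)) • ef (j + 1)

/-- The functional of the `n`-th step of the multiscale procedure with `Λ̃ = Λ e₁`,
`λ_n = α₀ M^n`, fidelity exponent `2`, regularization `R(w) = ‖w‖_{BV(ℝ)}`, at the
increment `w`, based at `σ_{n−1} = ∑_{j<n} u_j`. -/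
def JL (α0 M b : ℝ)
    (Λ : Lp ℝ 2 (volume : Measure ℝ) →L[ℝ] Lp ℝ 2 (volume : Measure ℝ))
    (n : ℕ) (w : Lp ℝ 2 (volume : Measure ℝ)) : ℝ≥0∞ :=
  ENNReal.ofReal (α0 * M ^ n *
      ‖Λ (ef 0) - Λ ((∑ j ∈ Finset.range n, uL b j) + w)‖ ^ 2) +
    BVnorm w

open scoped RealInnerProductSpace

lemma aseq_succ (j : ℕ) : aseq (j + 1) = bseq j + ((j : ℝ) + 1) ^ 2 := by
  simp only [aseq, bseq, Finset.sum_range_succ]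
  ring

lemma bseq_sub_aseq (j : ℕ) : bseq j - aseq j = 4 / ((j : ℝ) + 1) := by
  simp [bseq]

lemma aseq_le_bseq (j : ℕ) : aseq j ≤ bseq j := by
  have : 0 ≤ 4 / ((j : ℝ) + 1) := by positivity
  linarith [bseq_sub_aseq j]

lemma bseq_lt_aseq_succ (j : ℕ) : bseq j < aseq (j + 1) := by
  have : 0 < ((j : ℝ) + 1) ^ 2 := by positivity
  linarith [aseq_succ j]

lemma monotone_aseq : Monotone aseq :=
  monotone_nat_of_le_succ fun j => (aseq_le_bseq j).trans (bseq_lt_aseq_succ j).le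

lemma bseq_lt_aseq {i j : ℕ} (h : i < j) : bseq i < aseq j :=
  (bseq_lt_aseq_succ i).trans_le (monotone_aseq h)

lemma disjoint_intervals {i j : ℕ} (h : i ≠ j) :
    Disjoint (Set.Icc (aseq i) (bseq i)) (Set.Icc (aseq j) (bseq j)) := by
  rw [Set.disjoint_left]
  rintro x ⟨hi1, hi2⟩ ⟨hj1, hj2⟩
  rcases lt_or_gt_of_ne h with h | h
  · linarith [bseq_lt_aseq h]
  · linarith [bseq_lt_aseq h]

lemma disjoint_interval_gap (i j : ℕ) :
    Disjoint (Set.Icc (aseq i) (bseq i)) (Set.Ioo (bseq j) (aseq (j + 1))) := by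
  rw [Set.disjoint_left]
  rintro x ⟨hi1, hi2⟩ ⟨hj1, hj2⟩
  rcases le_or_gt i j with h | h
  · have : bseq i ≤ bseq j := by
      rcases h.eq_or_lt with rfl | h
      · exact le_rfl
      · exact (bseq_lt_aseq h).le.trans (aseq_le_bseq j)
    linarith
  · linarith [monotone_aseq (Nat.succ_le_of_lt h)]

lemma inner_ef (j : ℕ) (w : Lp ℝ 2 (volume : Measure ℝ)) :
    ⟪ef j, w⟫ = (-1 : ℝ) ^ (j + 1) * (√((j : ℝ) + 1) / 2) *
      ∫ x in Set.Icc (aseq j) (bseq j), w x := by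
  rw [ef, real_inner_smul_left, L2.inner_indicatorConstLp_one]

lemma inner_ef_of_ne {i j : ℕ} (h : i ≠ j) : ⟪ef i, ef j⟫ = 0 := by
  rw [ef, ef, real_inner_smul_left, real_inner_smul_right,
    L2.real_inner_indicatorConstLp_one_indicatorConstLp_one _ _ measure_Icc_lt_top.ne
      measure_Icc_lt_top.ne,
    (disjoint_intervals h).inter_eq]
  simp

lemma inner_ef_self (j : ℕ) : ⟪ef j, ef j⟫ = 1 := by
  rw [ef, real_inner_smul_left, real_inner_smul_right,
    L2.real_inner_indicatorConstLp_one_indicatorConstLp_one _ _ measure_Icc_lt_top.ne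
      measure_Icc_lt_top.ne, Set.inter_self,
    Real.volume_real_Icc_of_le (aseq_le_bseq j), bseq_sub_aseq]
  have h1 : ((-1 : ℝ) ^ (j + 1)) * (-1) ^ (j + 1) = 1 := by
    rw [← mul_pow]; simp
  have h2 : √((j : ℝ) + 1) * √((j : ℝ) + 1) = j + 1 := Real.mul_self_sqrt (by positivity)
  have h3 : (j : ℝ) + 1 ≠ 0 := by positivity
  calc _ = ((-1 : ℝ) ^ (j + 1) * (-1) ^ (j + 1)) * (√((j : ℝ) + 1) * √((j : ℝ) + 1)) / 4 *
        (4 / ((j : ℝ) + 1)) := by ring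
    _ = 1 := by rw [h1, h2]; field_simp

lemma inner_ef_ef (i j : ℕ) : ⟪ef i, ef j⟫ = if i = j then 1 else 0 := by
  split_ifs with h
  · rw [h, inner_ef_self]
  · exact inner_ef_of_ne h

lemma orthonormal_ef : Orthonormal ℝ ef := by
  rw [orthonormal_iff_ite]
  exact inner_ef_ef

lemma inner_ef_chiL (i j : ℕ) : ⟪ef i, chiL j⟫ = 0 := by
  rw [ef, chiL, real_inner_smul_left,
    L2.real_inner_indicatorConstLp_one_indicatorConstLp_one _ _ measure_Icc_lt_top.ne
      measure_Ioo_lt_top.ne,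
    (disjoint_interval_gap i j).inter_eq]
  simp

lemma inner_ef_of_mem_Kset (i : ℕ) {v : Lp ℝ 2 (volume : Measure ℝ)} (hv : v ∈ Kset) :
    ⟪ef i, v⟫ = 0 := by
  obtain ⟨κ, -, hκ⟩ := hv
  have h := hκ.mapL (innerSL ℝ (ef i))
  simp only [innerSL_apply_apply, real_inner_smul_right, inner_ef_chiL, mul_zero] at h
  exact h.unique hasSum_zero

/-- The mean value over `I_j`. -/
def intervalMean (j : ℕ) (w : ℝ → ℝ) : ℝ :=
  ((j : ℝ) + 1) / 4 * ∫ x in Set.Icc (aseq j) (bseq j), w x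

lemma intervalMean_eq_inner (j : ℕ) (w : Lp ℝ 2 (volume : Measure ℝ)) :
    intervalMean j w = (-1 : ℝ) ^ (j + 1) * (√((j : ℝ) + 1) / 2) * ⟪ef j, w⟫ := by
  have h1 : ((-1 : ℝ) ^ (j + 1)) * (-1) ^ (j + 1) = 1 := by
    rw [← mul_pow]; simp
  have h2 : √((j : ℝ) + 1) * √((j : ℝ) + 1) = j + 1 := Real.mul_self_sqrt (by positivity)
  rw [inner_ef, intervalMean]
  linear_combination (-((j : ℝ) + 1) / 4 * h1 - 1 / 4 * ((-1 : ℝ) ^ (j + 1) * (-1) ^ (j + 1)) * h2) *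
    ∫ x in Set.Icc (aseq j) (bseq j), w x

lemma intervalMean_eq_integral_unit (j : ℕ) (g : ℝ → ℝ) :
    intervalMean j g = ∫ θ in (0 : ℝ)..1, g (aseq j + 4 / ((j : ℝ) + 1) * θ) := by
  have h : 4 / ((j : ℝ) + 1) ≠ 0 := by positivity
  rw [intervalIntegral.integral_comp_add_mul _ h, mul_zero, add_zero, mul_one, intervalMean,
    integral_Icc_eq_integral_Ioc, ← intervalIntegral.integral_of_le (aseq_le_bseq j), smul_eq_mul,
    inv_div]
  rfl

lemma sum_sub_mul_eq (G v : ℕ → ℝ) (N : ℕ) :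
    ∑ j ∈ Finset.range N, (G (j + 1) - G j) * v (j + 1) =
      G N * v (N + 1) - G 0 * v 0 -
        ∑ i ∈ Finset.range (N + 1), G i * (v (i + 1) - v i) := by
  induction N with
  | zero => simp; ring
  | succ N ih =>
    rw [Finset.sum_range_succ, ih, Finset.sum_range_succ _ (N + 1)]
    ring

lemma exists_mem_abs_lt {g : ℝ → ℝ} (hg : MemLp g 2 volume) {ε : ℝ} (hε : 0 < ε) {s : Set ℝ}
    (hs : volume s = ⊤) : ∃ y ∈ s, |g y| < ε := by
  by_contra! h
  have h1 := hg.meas_ge_lt_top (by norm_num) (by norm_num) (ε := ε.toNNReal)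
    (by simpa using hε)
  refine (h1.trans_le' (measure_mono fun x hx => ?_)).ne hs
  exact Real.toNNReal_le_iff_le_coe.2 (by simpa using h x hx)

lemma sum_abs_sub_le {g : ℝ → ℝ} (hV : eVariationOn g Set.univ ≠ ⊤) {u : ℕ → ℝ} (hu : Monotone u)
    (n : ℕ) :
    ∑ i ∈ Finset.range n, |g (u (i + 1)) - g (u i)| ≤ (eVariationOn g Set.univ).toReal := by
  have h := eVariationOn.sum_le (f := g) (s := Set.univ) (n := n) hu (fun _ => Set.mem_univ _)
  rw [← ENNReal.ofReal_le_iff_le_toReal hV, ENNReal.ofReal_sum_of_nonneg fun _ _ => abs_nonneg _]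
  simpa only [edist_dist, Real.dist_eq] using h

lemma sum_mul_apply_le {g : ℝ → ℝ} (hg : MemLp g 2 volume) (hV : eVariationOn g Set.univ ≠ ⊤)
    {G : ℕ → ℝ} (hG : ∀ j, |G j| ≤ 1) {x : ℕ → ℝ} (hx : Monotone x) (N : ℕ) :
    ∑ j ∈ Finset.range N, (G (j + 1) - G j) * g (x j) ≤ (eVariationOn g Set.univ).toReal := by
  refine le_of_forall_pos_le_add fun ε hε => ?_
  obtain ⟨y₀, hy₀, hgy₀⟩ := exists_mem_abs_lt hg (half_pos hε) (s := Set.Iic (x 0)) (by simp)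
  obtain ⟨y₁, hy₁, hgy₁⟩ := exists_mem_abs_lt hg (half_pos hε) (s := Set.Ici (x N)) (by simp)
  simp only [Set.mem_Iic, Set.mem_Ici] at hy₀ hy₁
  set u : ℕ → ℝ := fun i => if i = 0 then y₀ else if i ≤ N then x (i - 1) else y₁ with hu
  have hmono : Monotone u := by
    refine monotone_nat_of_le_succ fun i => ?_
    rcases Nat.eq_zero_or_pos i with rfl | hi
    · by_cases h : 1 ≤ N
      · simpa [hu, h] using hy₀
      · simpa [hu, h] using hy₀.trans ((hx (Nat.zero_le N)).trans hy₁)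
    · by_cases h : i + 1 ≤ N
      · simpa [hu, h, hi.ne', (by omega : i ≤ N)] using hx (by omega)
      · by_cases h' : i ≤ N
        · simpa [hu, h, h', hi.ne'] using (hx (by omega : i - 1 ≤ N)).trans hy₁
        · simp [hu, h, h', hi.ne']
  have h1 : ∑ j ∈ Finset.range N, (G (j + 1) - G j) * g (x j) =
      ∑ j ∈ Finset.range N, (G (j + 1) - G j) * g (u (j + 1)) := by
    refine Finset.sum_congr rfl fun j hj => ?_
    have : j + 1 ≤ N := Finset.mem_range.1 hj
    simp [hu, this]
  have h2 := sum_abs_sub_le hV hmono (N + 1)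
  have h3 : -∑ i ∈ Finset.range (N + 1), G i * (g (u (i + 1)) - g (u i)) ≤
      ∑ i ∈ Finset.range (N + 1), |g (u (i + 1)) - g (u i)| := by
    rw [← Finset.sum_neg_distrib]
    refine Finset.sum_le_sum fun i _ => (neg_le_abs _).trans ?_
    rw [abs_mul]
    exact mul_le_of_le_one_left (abs_nonneg _) (hG i)
  have h4 : |G N * g y₁| ≤ ε / 2 := by
    rw [abs_mul]
    exact (mul_le_of_le_one_left (abs_nonneg _) (hG N)).trans hgy₁.le
  have h5 : |G 0 * g y₀| ≤ ε / 2 := by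
    rw [abs_mul]
    exact (mul_le_of_le_one_left (abs_nonneg _) (hG 0)).trans hgy₀.le
  have e1 : u (N + 1) = y₁ := by simp [hu]
  have e0 : u 0 = y₀ := by simp [hu]
  rw [h1, sum_sub_mul_eq G (fun i => g (u i)) N]
  simp only [e1, e0]
  linarith [le_abs_self (G N * g y₁), neg_le_abs (G 0 * g y₀)]

/-- The duality bound for the total variation: a step function whose primitive is bounded by `1`
pairs with `w` to at most `BVnorm w`. -/
lemma ofReal_sum_intervalMean_le_BVnorm (w : Lp ℝ 2 (volume : Measure ℝ)) {G : ℕ → ℝ}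
    (hG : ∀ j, |G j| ≤ 1) (N : ℕ) :
    ENNReal.ofReal (∑ j ∈ Finset.range N, (G (j + 1) - G j) * intervalMean j w) ≤ BVnorm w := by
  rw [BVnorm]
  refine le_sInf ?_
  rintro _ ⟨g, hgw, rfl⟩
  replace hgw : g =ᵐ[volume] w := hgw
  beta_reduce
  by_cases hV : eVariationOn g Set.univ = ⊤
  · simp [hV]
  have hg : MemLp g 2 volume := (memLp_congr_ae hgw).2 (Lp.memLp w)
  have hmean (j : ℕ) : intervalMean j w = intervalMean j g := by
    rw [intervalMean, intervalMean]
    congr 1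
    exact integral_congr_ae (ae_restrict_of_ae hgw.symm)
  have hint (j : ℕ) : IntervalIntegrable (fun θ => g (aseq j + 4 / ((j : ℝ) + 1) * θ))
      volume 0 1 := by
    have hc : 4 / ((j : ℝ) + 1) ≠ 0 := by positivity
    have h1 : IntervalIntegrable g volume (aseq j) (bseq j) :=
      ((hg.locallyIntegrable (by norm_num)).integrableOn_isCompact
        isCompact_uIcc).intervalIntegrable
    have h2 := (h1.comp_add_left (aseq j)).comp_mul_left (c := 4 / ((j : ℝ) + 1))
    rwa [bseq_sub_aseq, div_self hc, sub_self, zero_div] at h2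
  rw [← ENNReal.ofReal_toReal hV]
  refine ENNReal.ofReal_le_ofReal ?_
  calc ∑ j ∈ Finset.range N, (G (j + 1) - G j) * intervalMean j w
      = ∫ θ in (0 : ℝ)..1, ∑ j ∈ Finset.range N,
          (G (j + 1) - G j) * g (aseq j + 4 / ((j : ℝ) + 1) * θ) := by
        rw [intervalIntegral.integral_finsetSum fun j _ => (hint j).const_mul _]
        refine Finset.sum_congr rfl fun j _ => ?_
        rw [intervalIntegral.integral_const_mul, hmean, intervalMean_eq_integral_unit]
    _ ≤ ∫ θ in (0 : ℝ)..1, (eVariationOn g Set.univ).toReal := by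
        refine intervalIntegral.integral_mono_on zero_le_one
          (by
            simpa only [← Finset.sum_fn] using IntervalIntegrable.sum (Finset.range N)
              fun j _ => (hint j).const_mul (G (j + 1) - G j))
          intervalIntegrable_const fun θ hθ => ?_
        refine sum_mul_apply_le hg hV hG (monotone_nat_of_le_succ fun j => ?_) N
        have h1 : 4 / ((j : ℝ) + 1) * θ ≤ 4 / ((j : ℝ) + 1) :=
          mul_le_of_le_one_right (by positivity) hθ.2
        have h2 : 0 ≤ 4 / (((j + 1 : ℕ) : ℝ) + 1) * θ := mul_nonneg (by positivity) hθ.1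
        linarith [bseq_lt_aseq_succ j, bseq_sub_aseq j]
    _ = _ := by simp

lemma eVariationOn_add_le {α : Type*} [LinearOrder α] (f g : α → ℝ) (s : Set α) :
    eVariationOn (fun x => f x + g x) s ≤ eVariationOn f s + eVariationOn g s := by
  refine iSup_le fun p => ?_
  calc _ ≤ ∑ i ∈ Finset.range p.1, (edist (f (p.2.1 (i + 1))) (f (p.2.1 i)) +
        edist (g (p.2.1 (i + 1))) (g (p.2.1 i))) :=
        Finset.sum_le_sum fun i _ => edist_add_add_le _ _ _ _
    _ ≤ _ := by
        rw [Finset.sum_add_distrib]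
        exact add_le_add (eVariationOn.sum_le p.2.2.1 p.2.2.2)
          (eVariationOn.sum_le p.2.2.1 p.2.2.2)

lemma eVariationOn_const_mul_le {H : ℝ → ℝ} (hH : Monotone H) (h0 : ∀ x, 0 ≤ H x)
    (h1 : ∀ x, H x ≤ 1) (c : ℝ) :
    eVariationOn (fun x => c * H x) Set.univ ≤ ENNReal.ofReal |c| := by
  refine iSup_le fun p => ?_
  have h (i : ℕ) : edist (c * H (p.2.1 (i + 1))) (c * H (p.2.1 i)) =
      ENNReal.ofReal (|c| * (H (p.2.1 (i + 1)) - H (p.2.1 i))) := by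
    rw [edist_dist, Real.dist_eq, ← mul_sub, abs_mul,
      abs_of_nonneg (sub_nonneg.2 (hH (p.2.2.1 (Nat.le_succ i))))]
  simp only [h]
  rw [← ENNReal.ofReal_sum_of_nonneg fun i _ => mul_nonneg (abs_nonneg c)
    (sub_nonneg.2 (hH (p.2.2.1 (Nat.le_succ i)))), ← Finset.mul_sum,
    Finset.sum_range_sub (fun i => H (p.2.1 i))]
  refine ENNReal.ofReal_le_ofReal (mul_le_of_le_one_right (abs_nonneg c) ?_)
  linarith [h0 (p.2.1 0), h1 (p.2.1 p.1)]

lemma eVariationOn_indicator_Icc_le {a b : ℝ} (hab : a ≤ b) (c : ℝ) :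
    eVariationOn ((Set.Icc a b).indicator fun _ => c) Set.univ ≤ ENNReal.ofReal (2 * |c|) := by
  have h : (Set.Icc a b).indicator (fun _ => c) = fun x =>
      c * (if a ≤ x then 1 else 0) + -c * (if b < x then 1 else 0) := by
    ext x
    by_cases h1 : a ≤ x <;> by_cases h2 : b < x
    · simp [Set.indicator, h1, h2]
    · simp [Set.indicator, h1, h2, not_lt.1 h2]
    · exact absurd (hab.trans h2.le) h1
    · simp [Set.indicator, h1, h2]
  rw [h, two_mul, ENNReal.ofReal_add (abs_nonneg c) (abs_nonneg c)]
  refine (eVariationOn_add_le _ _ _).trans (add_le_add ?_ ?_)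
  · refine eVariationOn_const_mul_le (fun x y hxy => ?_) (fun x => ?_) (fun x => ?_) c
    · grind
    · split_ifs <;> norm_num
    · split_ifs <;> norm_num
  · rw [← abs_neg c]
    refine eVariationOn_const_mul_le (fun x y hxy => ?_) (fun x => ?_) (fun x => ?_) (-c)
    · grind
    · split_ifs <;> norm_num
    · split_ifs <;> norm_num

lemma exists_ae_eq_uL {b : ℝ} (hb : 0 < b) (j : ℕ) :
    ∃ g : ℝ → ℝ, g =ᵐ[volume] uL b j ∧ eVariationOn g Set.univ ≤ ENNReal.ofReal b := by
  refine ⟨(Set.Icc (aseq (j + 1)) (bseq (j + 1))).indicator fun _ => (-1 : ℝ) ^ j * (b / 2),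
    ?_, (eVariationOn_indicator_Icc_le (aseq_le_bseq _) _).trans_eq ?_⟩
  · have hc : b / √((j : ℝ) + 2) * ((-1 : ℝ) ^ (j + 1 + 1) * (√(((j + 1 : ℕ) : ℝ) + 1) / 2)) =
        (-1 : ℝ) ^ j * (b / 2) := by
      have h : √((j : ℝ) + 2) ≠ 0 := by positivity
      have h' : ((j + 1 : ℕ) : ℝ) + 1 = j + 2 := by push_cast; ring
      rw [h']
      field_simp
      ring
    rw [uL, ef, smul_smul, hc]
    filter_upwards [Lp.coeFn_smul ((-1 : ℝ) ^ j * (b / 2)) (indicatorConstLp 2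
      (measurableSet_Icc (a := aseq (j + 1)) (b := bseq (j + 1)))
      (by rw [Real.volume_Icc]; exact ENNReal.ofReal_ne_top) (1 : ℝ)),
      indicatorConstLp_coeFn (p := 2) (c := (1 : ℝ)) (hs := measurableSet_Icc
        (a := aseq (j + 1)) (b := bseq (j + 1))) (μ := volume)
        (hμs := by rw [Real.volume_Icc]; exact ENNReal.ofReal_ne_top)] with x h1 h2
    rw [h1, Pi.smul_apply, h2]
    by_cases hx : x ∈ Set.Icc (aseq (j + 1)) (bseq (j + 1)) <;> simp [hx]
  · congr 1
    rw [abs_mul, abs_pow, abs_neg, abs_one, one_pow, one_mul, abs_of_pos (by positivity)]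
    ring

lemma exists_ae_eq_sum_uL {b : ℝ} (hb : 0 < b) (n : ℕ) :
    ∃ g : ℝ → ℝ, g =ᵐ[volume] (∑ j ∈ Finset.range n, uL b j : Lp ℝ 2 (volume : Measure ℝ)) ∧
      eVariationOn g Set.univ ≤ ENNReal.ofReal (b * n) := by
  induction n with
  | zero =>
    refine ⟨0, ?_, ?_⟩
    · simpa using (Lp.coeFn_zero ℝ 2 (volume : Measure ℝ)).symm
    · rw [eVariationOn.constant_on (by rintro _ ⟨x, -, rfl⟩ _ ⟨y, -, rfl⟩; rfl)]
      exact zero_le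
  | succ n ih =>
    obtain ⟨g, hg, hgv⟩ := ih
    obtain ⟨f, hf, hfv⟩ := exists_ae_eq_uL hb n
    refine ⟨fun x => g x + f x, ?_, (eVariationOn_add_le _ _ _).trans ?_⟩
    · rw [Finset.sum_range_succ]
      filter_upwards [hg, hf, Lp.coeFn_add (∑ j ∈ Finset.range n, uL b j) (uL b n)] with x h1 h2 h3
      rw [h1, h2, h3, Pi.add_apply]
    · refine (add_le_add hgv hfv).trans_eq ?_
      rw [← ENNReal.ofReal_add (by positivity) hb.le]
      congr 1
      push_cast
      ring

lemma BVnorm_le_of_ae_eq {w : Lp ℝ 2 (volume : Measure ℝ)} {g : ℝ → ℝ} (h : g =ᵐ[volume] w) :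
    BVnorm w ≤ eVariationOn g Set.univ :=
  sInf_le ⟨g, h, rfl⟩

lemma BVnorm_uL_le {b : ℝ} (hb : 0 < b) (j : ℕ) : BVnorm (uL b j) ≤ ENNReal.ofReal b := by
  obtain ⟨g, hg, hgv⟩ := exists_ae_eq_uL hb j
  exact (BVnorm_le_of_ae_eq hg).trans hgv

lemma inner_ef_sum_uL (b : ℝ) (n m : ℕ) :
    ⟪ef m, ∑ j ∈ Finset.range n, uL b j⟫ =
      if m = 0 ∨ n < m then 0 else b / √((m : ℝ) + 1) := by
  simp only [inner_sum, uL, real_inner_smul_right, inner_ef_ef, mul_ite, mul_one, mul_zero]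
  rcases m with _ | m
  · simp
  · simp only [Nat.add_right_cancel_iff, Finset.sum_ite_eq, Finset.mem_range, Nat.cast_add,
      Nat.cast_one, Nat.add_eq_zero_iff, one_ne_zero, and_false, false_or]
    have : (m : ℝ) + 2 = m + 1 + 1 := by ring
    rw [this]
    grind

lemma intervalMean_sum_uL (b : ℝ) (n m : ℕ) :
    intervalMean m (∑ j ∈ Finset.range n, uL b j : Lp ℝ 2 (volume : Measure ℝ)) =
      if m = 0 ∨ n < m then 0 else (-1 : ℝ) ^ (m + 1) * (b / 2) := by
  rw [intervalMean_eq_inner, inner_ef_sum_uL]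
  split_ifs
  · simp
  · have : √((m : ℝ) + 1) ≠ 0 := by positivity
    field_simp

lemma BVnorm_sum_uL {b : ℝ} (hb : 0 < b) (n : ℕ) :
    BVnorm (∑ j ∈ Finset.range n, uL b j) = ENNReal.ofReal (b * n) := by
  refine le_antisymm ?_ ?_
  · obtain ⟨g, hg, hgv⟩ := exists_ae_eq_sum_uL hb n
    exact (BVnorm_le_of_ae_eq hg).trans hgv
  · refine le_trans (ENNReal.ofReal_le_ofReal (le_of_eq ?_)) (ofReal_sum_intervalMean_le_BVnorm _
      (G := fun j => (-1 : ℝ) ^ j) (fun j => by simp) (n + 1))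
    rw [Finset.sum_range_succ', intervalMean_sum_uL]
    have h (j : ℕ) (hj : j ∈ Finset.range n) :
        ((-1 : ℝ) ^ (j + 1 + 1) - (-1) ^ (j + 1)) *
          intervalMean (j + 1) (∑ j ∈ Finset.range n, uL b j : Lp ℝ 2 (volume : Measure ℝ)) = b := by
      rw [intervalMean_sum_uL, if_neg (by have := Finset.mem_range.1 hj; omega)]
      have h1 : ((-1 : ℝ) ^ j) * (-1) ^ j = 1 := by
        rw [← mul_pow]; simp
      linear_combination b * h1
    rw [Finset.sum_congr rfl h]
    simp [mul_comm]

lemma norm_sq_sum_uL (b : ℝ) (n : ℕ) :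
    ‖∑ j ∈ Finset.range n, uL b j‖ ^ 2 = b ^ 2 * ∑ j ∈ Finset.range n, 1 / ((j : ℝ) + 2) := by
  have h := orthonormal_ef.comp (fun j : ℕ => j + 1) (add_left_injective 1)
  rw [← real_inner_self_eq_norm_sq, Finset.mul_sum]
  simp only [uL]
  refine (h.inner_sum (fun j : ℕ => b / √((j : ℝ) + 2)) (fun j : ℕ => b / √((j : ℝ) + 2))
    (Finset.range n)).trans ?_
  refine Finset.sum_congr rfl fun j _ => ?_
  have h2 : √((j : ℝ) + 2) * √((j : ℝ) + 2) = j + 2 := Real.mul_self_sqrt (by positivity)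
  rw [conj_trivial, div_mul_div_comm, h2]
  ring

lemma tendsto_sum_one_div_add_two :
    Tendsto (fun n => ∑ j ∈ Finset.range n, 1 / ((j : ℝ) + 2)) atTop atTop := by
  have h := tendsto_atTop_add_const_right atTop (-1 : ℝ)
    (Real.tendsto_sum_range_one_div_nat_succ_atTop.comp (tendsto_add_atTop_nat 1))
  refine h.congr fun n => ?_
  simp only [Function.comp_apply]
  rw [Finset.sum_range_succ']
  simp only [Nat.cast_add, Nat.cast_one, CharP.cast_eq_zero, zero_add, div_one]
  rw [add_neg_cancel_right]
  refine Finset.sum_congr rfl fun j _ => by ring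

lemma tendsto_norm_sum_uL {b : ℝ} (hb : 0 < b) :
    Tendsto (fun n => ‖∑ j ∈ Finset.range n, uL b j‖) atTop atTop := by
  have h : Tendsto (fun n => √(b ^ 2 * ∑ j ∈ Finset.range n, 1 / ((j : ℝ) + 2))) atTop atTop :=
    Real.tendsto_sqrt_atTop.comp
      (Tendsto.const_mul_atTop (by positivity) tendsto_sum_one_div_add_two)
  refine h.congr fun n => ?_
  rw [← norm_sq_sum_uL, Real.sqrt_sq (norm_nonneg _)]

lemma ofReal_le_eLpNorm_one_sum_uL {b : ℝ} (hb : 0 < b) (n : ℕ) :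
    ENNReal.ofReal (2 * b * ∑ j ∈ Finset.range n, 1 / ((j : ℝ) + 2)) ≤
      eLpNorm (∑ j ∈ Finset.range n, uL b j : Lp ℝ 2 (volume : Measure ℝ)) 1 volume := by
  set σ : Lp ℝ 2 (volume : Measure ℝ) := ∑ j ∈ Finset.range n, uL b j with hσ
  rw [eLpNorm_one_eq_lintegral_enorm, Finset.mul_sum,
    ENNReal.ofReal_sum_of_nonneg fun j _ => by positivity]
  calc _ ≤ ∑ j ∈ Finset.range n, ∫⁻ x in Set.Icc (aseq (j + 1)) (bseq (j + 1)), ‖σ x‖ₑ := by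
        refine Finset.sum_le_sum fun j hj => le_trans ?_ (enorm_integral_le_lintegral_enorm _)
        have h := intervalMean_sum_uL b n (j + 1)
        rw [if_neg (by have := Finset.mem_range.1 hj; omega), ← hσ, intervalMean] at h
        have h2 : ∫ x in Set.Icc (aseq (j + 1)) (bseq (j + 1)), σ x =
            (-1 : ℝ) ^ j * (2 * b * (1 / ((j : ℝ) + 2))) := by
          have h3 : (j : ℝ) + 2 ≠ 0 := by positivity
          have h4 : ((j + 1 : ℕ) : ℝ) + 1 = j + 2 := by push_cast; ring
          rw [h4] at h
          field_simp
          linear_combination 4 * h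
        rw [h2, ← ofReal_norm, norm_mul, norm_pow, norm_neg, norm_one, one_pow, one_mul,
          Real.norm_of_nonneg (by positivity)]
    _ = ∫⁻ x in ⋃ j ∈ Finset.range n, Set.Icc (aseq (j + 1)) (bseq (j + 1)), ‖σ x‖ₑ := by
        rw [lintegral_biUnion_finset (fun i _ j _ hij => disjoint_intervals (by simpa using hij))
          fun _ _ => measurableSet_Icc]
    _ ≤ _ := setLIntegral_le_lintegral _ _

lemma tendsto_eLpNorm_one_sum_uL {b : ℝ} (hb : 0 < b) :
    Tendsto (fun n : ℕ => eLpNorm (⇑(∑ j ∈ Finset.range n, uL b j)) 1 volume)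
      atTop (𝓝 ⊤) := by
  refine tendsto_nhds_top_mono (ENNReal.tendsto_ofReal_atTop.comp
    (Tendsto.const_mul_atTop (by positivity : 0 < 2 * b) tendsto_sum_one_div_add_two))
    (Eventually.of_forall fun n => ofReal_le_eLpNorm_one_sum_uL hb n)

lemma exists_hasSum_ef (w : Lp ℝ 2 (volume : Measure ℝ)) :
    ∃ h : Lp ℝ 2 (volume : Measure ℝ), HasSum (fun j => ⟪ef j, w⟫ • ef j) h ∧
      ∀ m, ⟪ef m, w - h⟫ = 0 := by
  have hs : Summable fun j => ⟪ef j, w⟫ • ef j := by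
    have := (orthonormal_ef.orthogonalFamily.summable_iff_norm_sq_summable
      fun j => ⟪ef j, w⟫).2 (orthonormal_ef.inner_products_summable w)
    simpa using this
  refine ⟨_, hs.hasSum, fun m => ?_⟩
  have h := hs.hasSum.mapL (innerSL ℝ (ef m))
  simp only [innerSL_apply_apply, real_inner_smul_right, inner_ef_ef, mul_ite, mul_one,
    mul_zero] at h
  have h2 := h.unique (hasSum_single m fun j hj => if_neg hj.symm)
  rw [inner_sub_right, h2, if_pos rfl, sub_self]

lemma mem_Htilde_orthogonal_iff {d : Lp ℝ 2 (volume : Measure ℝ)} :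
    d ∈ Htildeᗮ ↔ ∀ m, ⟪ef m, d⟫ = 0 := by
  rw [Htilde, Submodule.orthogonal_closure, Submodule.mem_orthogonal]
  refine ⟨fun h m => h _ (Submodule.subset_span ⟨m, rfl⟩), fun h u hu => ?_⟩
  induction hu using Submodule.span_induction with
  | mem x hx => obtain ⟨m, rfl⟩ := hx; exact h m
  | zero => simp
  | add x y _ _ hx hy => rw [inner_add_left, hx, hy, add_zero]
  | smul a x _ hx => rw [real_inner_smul_left, hx, mul_zero]

variable {c0 M δ b : ℝ} {k : ℕ}
  {Λ : Lp ℝ 2 (volume : Measure ℝ) →L[ℝ] Lp ℝ 2 (volume : Measure ℝ)}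

/-- `Λ` is the identity on the orthogonal complement of the system `{e_j}`. -/
lemma LamSpec.apply_eq_self (hΛ : LamSpec c0 M δ b k Λ) {d : Lp ℝ 2 (volume : Measure ℝ)}
    (hd : ∀ m, ⟪ef m, d⟫ = 0) : Λ d = d := by
  have : CompleteSpace Htilde := (Submodule.isClosed_topologicalClosure _).completeSpace_coe
  set R : Lp ℝ 2 (volume : Measure ℝ) →L[ℝ] Lp ℝ 2 (volume : Measure ℝ) :=
    (Λ - ContinuousLinearMap.id ℝ _).comp Htildeᗮ.starProjection with hR
  have hRorth {x : Lp ℝ 2 (volume : Measure ℝ)} (hx : x ∈ Htildeᗮ) : R x = Λ x - x := by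
    simp [hR, Submodule.starProjection_eq_self_iff.2 hx]
  set S := Htilde ⊔ Submodule.span ℝ Kset with hS
  have h1 : S ≤ LinearMap.ker R.toLinearMap := by
    refine sup_le (fun x hx => ?_) (Submodule.span_le.2 fun x hx => ?_)
    · have : Htildeᗮ.starProjection x = 0 := by
        rw [Submodule.starProjection_apply_eq_zero_iff]
        exact Submodule.le_orthogonal_orthogonal _ hx
      simp [hR, this]
    · have hx' : x ∈ Htildeᗮ := mem_Htilde_orthogonal_iff.2 fun m => inner_ef_of_mem_Kset m hx
      simp [hRorth hx', hΛ.2.2.1 x hx]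
  have h2 : Sᗮ ≤ LinearMap.ker R.toLinearMap := fun x hx => by
    have hx' : x ∈ Htildeᗮ := Submodule.orthogonal_le le_sup_left hx
    simp [hRorth hx', hΛ.2.2.2 x hx]
  have h3 : (LinearMap.ker R.toLinearMap).topologicalClosure = ⊤ := by
    rw [Submodule.topologicalClosure_eq_top_iff, eq_bot_iff]
    have := Submodule.orthogonal_le (sup_le h1 h2)
    rwa [← Submodule.inf_orthogonal, Submodule.inf_orthogonal_eq_bot] at this
  have h4 : LinearMap.ker R.toLinearMap = ⊤ := by
    rw [← h3]
    exact (IsClosed.submodule_topologicalClosure_eq R.isClosed_ker).symm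
  have h5 : R d = 0 := by
    have : d ∈ LinearMap.ker R.toLinearMap := h4 ▸ Submodule.mem_top
    simpa using this
  rw [hRorth (mem_Htilde_orthogonal_iff.2 hd)] at h5
  exact sub_eq_zero.1 h5

/-- The partial sums of the effective coefficients of `Λ e_j` for `k = 5`, `δ = 2/11`, extended
by zero to negative indices. -/
def profile (l : ℤ) : ℝ := min 1 (max 0 ((2 * l + 1) / 11))

/-- The effective coefficients of `Λ e_j` for `k = 5`, `δ = 2/11`. -/
def kernelCoef (i : ℕ) : ℝ := if i = 0 then 1 / 11 else 2 / 11

lemma profile_nonneg (l : ℤ) : 0 ≤ profile l := le_min zero_le_one (le_max_left _ _)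

lemma profile_le_one (l : ℤ) : profile l ≤ 1 := min_le_left _ _

lemma profile_of_neg {l : ℤ} (h : l < 0) : profile l = 0 := by
  have : (l : ℝ) ≤ -1 := by exact_mod_cast (by omega : l ≤ -1)
  rw [profile, max_eq_left (by linarith), min_eq_right zero_le_one]

lemma profile_of_nonneg_of_le {l : ℤ} (h : 0 ≤ l) (h' : l ≤ 5) : profile l = (2 * l + 1) / 11 := by
  have h1 : (0 : ℝ) ≤ l := by exact_mod_cast h
  have h2 : (l : ℝ) ≤ 5 := by exact_mod_cast h'
  rw [profile, max_eq_right (by linarith), min_eq_right (by linarith)]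

lemma profile_of_ge {l : ℤ} (h : 5 ≤ l) : profile l = 1 := by
  have h1 : (5 : ℝ) ≤ l := by exact_mod_cast h
  rw [profile, max_eq_right (by linarith), min_eq_left (by linarith)]

lemma profile_sub_profile (d : ℕ) :
    profile d - profile (d - 1) = if d < 6 then kernelCoef d else 0 := by
  split_ifs with h
  · rcases d with _ | d
    · rw [profile_of_neg (l := ((0 : ℕ) : ℤ) - 1) (by simp),
        profile_of_nonneg_of_le (by simp) (by simp)]
      simp [kernelCoef]
    · rw [profile_of_nonneg_of_le (by omega) (by omega),
        profile_of_nonneg_of_le (by omega) (by omega)]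
      simp [kernelCoef]
      ring
  · rw [profile_of_ge (by omega), profile_of_ge (by omega), sub_self]

lemma LamSpec.apply_ef_succ (hΛ : LamSpec c0 M (2 / 11) b 5 Λ) (j : ℕ) :
    Λ (ef (j + 1)) = (√((j : ℝ) + 2) / b) •
      ∑ i ∈ Finset.range 6, (kernelCoef i * eta c0 M (j + i + 1)) • ef (j + i) := by
  rw [hΛ.2.1 (j + 1) (by omega)]
  have h : ((j + 1 : ℕ) : ℝ) + 1 = j + 2 := by push_cast; ring
  have hI : Finset.Icc 1 5 = {1, 2, 3, 4, 5} := rfl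
  rw [h, hI]
  congr 1
  simp [Finset.sum_range_succ, Acoef, mu, kernelCoef, add_assoc, add_comm 1]
  module

lemma LamSpec.apply_uL (hb : b ≠ 0) (hΛ : LamSpec c0 M (2 / 11) b 5 Λ) (j : ℕ) :
    Λ (uL b j) = ∑ i ∈ Finset.range 6, (kernelCoef i * eta c0 M (j + i + 1)) • ef (j + i) := by
  have h : √((j : ℝ) + 2) ≠ 0 := by positivity
  rw [uL, map_smul, hΛ.apply_ef_succ, smul_smul]
  rw [div_mul_div_cancel₀ h, div_self hb, one_smul]

lemma LamSpec.inner_ef_apply_uL (hb : b ≠ 0) (hΛ : LamSpec c0 M (2 / 11) b 5 Λ) (m j : ℕ) :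
    ⟪ef m, Λ (uL b j)⟫ = eta c0 M (m + 1) * (profile (m - j) - profile (m - j - 1)) := by
  rw [hΛ.apply_uL hb]
  simp only [inner_sum, real_inner_smul_right, inner_ef_ef, mul_ite, mul_one, mul_zero]
  rcases lt_or_ge m j with h | h
  · rw [profile_of_neg (by omega), profile_of_neg (by omega), sub_self, mul_zero]
    exact Finset.sum_eq_zero fun i _ => if_neg (by omega)
  · obtain ⟨d, rfl⟩ := Nat.exists_eq_add_of_le h
    have e : ((j + d : ℕ) : ℤ) - j = d := by omega
    rw [e, profile_sub_profile]
    simp only [Nat.add_left_cancel_iff, Finset.sum_ite_eq, Finset.mem_range]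
    split_ifs <;> ring

lemma eta_sq (hc : 0 ≤ c0) (hM : 0 < M) (m : ℕ) : eta c0 M m ^ 2 = c0 / M ^ m := by
  rw [eta, Real.sq_sqrt (by positivity)]

lemma eta_pos (hc : 0 < c0) (hM : 0 < M) (m : ℕ) : 0 < eta c0 M m := by
  rw [eta]
  positivity

lemma summable_eta (hc : 0 ≤ c0) (hM : 2 ≤ M) : Summable fun m => eta c0 M m := by
  have h (m : ℕ) : eta c0 M m = √c0 * (√(1 / M)) ^ m := by
    rw [eta, div_eq_mul_one_div, Real.sqrt_mul hc, ← one_div_pow]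
    congr 1
    rw [Real.sqrt_eq_iff_mul_self_eq (by positivity) (by positivity), ← mul_pow,
      Real.mul_self_sqrt (by positivity)]
  simp only [h]
  refine (summable_geometric_of_lt_one (Real.sqrt_nonneg _) ?_).mul_left _
  rw [Real.sqrt_lt' one_pos, div_lt_iff₀ (by linarith)]
  linarith

lemma summable_smul_ef (hc : 0 < c0) (hM : 2 ≤ M) {a : ℕ → ℝ}
    (ha : ∀ m, |a m| ≤ 1) : Summable fun m => (a m * eta c0 M (m + 1)) • ef m := by
  refine Summable.of_norm_bounded ((summable_nat_add_iff 1).2 (summable_eta hc.le hM)) fun m => ?_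
  rw [norm_smul, orthonormal_ef.1, mul_one, norm_mul, Real.norm_eq_abs, Real.norm_eq_abs,
    abs_of_pos (eta_pos hc (by linarith) _)]
  exact mul_le_of_le_one_left (eta_pos hc (by linarith) _).le (ha m)

lemma LamSpec.hasSum_apply_ef_zero (hc : 0 < c0) (hM : 2 ≤ M)
    (hΛ : LamSpec c0 M (2 / 11) b 5 Λ) :
    HasSum (fun m : ℕ => (profile m * eta c0 M (m + 1)) • ef m) (Λ (ef 0)) := by
  have h1 : Summable fun m : ℕ => if 5 ≤ m then eta c0 M (m + 1) • ef m else 0 := by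
    refine (summable_smul_ef hc hM (a := fun m => if 5 ≤ m then 1 else 0)
      fun m => by split_ifs <;> simp).congr fun m => ?_
    split_ifs <;> simp
  have h2 : HasSum (fun m : ℕ => if m < 5 then (profile m * eta c0 M (m + 1)) • ef m else 0)
      (∑ m ∈ Finset.range 5, if m < 5 then (profile m * eta c0 M (m + 1)) • ef m else 0) :=
    hasSum_sum_of_ne_finset_zero fun m hm => if_neg (by simpa using hm)
  have hI : Finset.Icc 1 5 = {1, 2, 3, 4, 5} := rfl
  have hC1 : Ccoef 5 (2 / 11) 1 = 1 / 11 := by simp [Ccoef, Acoef]; norm_num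
  have hC2 : Ccoef 5 (2 / 11) 2 = 3 / 11 := by
    simp [Ccoef, Acoef, Finset.sum_Icc_succ_top]; norm_num
  have hC3 : Ccoef 5 (2 / 11) 3 = 5 / 11 := by
    simp [Ccoef, Acoef, Finset.sum_Icc_succ_top]; norm_num
  have hC4 : Ccoef 5 (2 / 11) 4 = 7 / 11 := by
    simp [Ccoef, Acoef, Finset.sum_Icc_succ_top]; norm_num
  have hC5 : Ccoef 5 (2 / 11) 5 = 1 := by
    simp [Ccoef, Acoef, Finset.sum_Icc_succ_top]; norm_num
  have hp (l : ℤ) (h : 0 ≤ l) (h' : l ≤ 5) := profile_of_nonneg_of_le h h'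
  convert! h2.add h1.hasSum using 1
  · ext1 m
    by_cases hm : m < 5
    · simp [hm, not_le.2 hm]
    · simp [hm, not_lt.1 hm, profile_of_ge (l := m) (by omega)]
  · rw [hΛ.1, hI]
    simp only [Finset.sum_range_succ, Finset.sum_range_zero]
    simp [hp, hC1, hC2, hC3, hC4, hC5, mu]
    module

lemma LamSpec.inner_ef_apply_ef_zero (hc : 0 < c0) (hM : 2 ≤ M)
    (hΛ : LamSpec c0 M (2 / 11) b 5 Λ) (m : ℕ) :
    ⟪ef m, Λ (ef 0)⟫ = eta c0 M (m + 1) * profile m := by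
  have h := (hΛ.hasSum_apply_ef_zero hc hM).mapL (innerSL ℝ (ef m))
  simp only [innerSL_apply_apply, real_inner_smul_right, inner_ef_ef, mul_ite, mul_one,
    mul_zero] at h
  have h2 := h.unique (hasSum_single m fun j hj => if_neg hj.symm)
  rw [h2, if_pos rfl, mul_comm]

/-- The residual of the multiscale procedure keeps its shape from step to step. -/
lemma LamSpec.inner_ef_residual (hb : b ≠ 0) (hc : 0 < c0) (hM : 2 ≤ M)
    (hΛ : LamSpec c0 M (2 / 11) b 5 Λ) (n m : ℕ) :
    ⟪ef m, Λ (ef 0) - Λ (∑ j ∈ Finset.range n, uL b j)⟫ =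
      eta c0 M (m + 1) * profile (m - n) := by
  induction n with
  | zero => simp [hΛ.inner_ef_apply_ef_zero hc hM]
  | succ n ih =>
    rw [Finset.sum_range_succ, map_add, ← sub_sub, inner_sub_right, ih,
      hΛ.inner_ef_apply_uL hb]
    have : (m : ℤ) - (n + 1 : ℕ) = m - n - 1 := by push_cast; ring
    rw [this]
    ring

/-- The sequence with `φ 0 = 1` and `φ (s + 1) + φ s = 2 τ (s + 1)`. -/
def reflectSeq (τ : ℕ → ℝ) : ℕ → ℝ
  | 0 => 1
  | s + 1 => 2 * τ (s + 1) - reflectSeq τ s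

lemma reflectSeq_mem {τ : ℕ → ℝ} (hτ : Antitone τ) (h0 : τ 0 = 1) (s : ℕ) :
    2 * τ s - 1 ≤ reflectSeq τ s ∧ reflectSeq τ s ≤ 1 := by
  induction s with
  | zero => simp [reflectSeq, h0]; norm_num
  | succ s ih =>
    have := hτ (Nat.le_succ s)
    simp only [reflectSeq]
    constructor <;> linarith

lemma abs_reflectSeq_le {τ : ℕ → ℝ} (hτ : Antitone τ) (h0 : τ 0 = 1) (hn : ∀ s, 0 ≤ τ s) (s : ℕ) :
    |reflectSeq τ s| ≤ 1 := by
  have := reflectSeq_mem hτ h0 s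
  rw [abs_le]
  constructor <;> linarith [hn s]

lemma le_reflectSeq {τ : ℕ → ℝ} (hτ : Antitone τ) (hn : ∀ s, 0 ≤ τ s) {κ : ℝ}
    (h1 : κ ≤ 2 * (1 - τ 1)) (h2 : κ ≤ 2 * (τ 1 - τ 2)) (s : ℕ) :
    -1 + κ ≤ reflectSeq τ s := by
  have key (s : ℕ) : 2 * τ (s + 2) - 1 + κ ≤ reflectSeq τ (s + 2) ∧
      reflectSeq τ (s + 2) ≤ 1 - κ := by
    induction s with
    | zero =>
      simp only [reflectSeq, zero_add]
      constructor <;> linarith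
    | succ s ih =>
      have := hτ (Nat.le_succ (s + 2))
      rw [show s + 1 + 2 = (s + 2) + 1 from rfl, reflectSeq]
      simp only [Nat.succ_eq_add_one] at this
      constructor <;> linarith
  rcases s with _ | _ | s
  · simp only [reflectSeq]
    linarith [hn 1]
  · simp only [reflectSeq, zero_add]
    linarith [hn 2]
  · linarith [hn (s + 2), (key s).1]

lemma exists_calibration {τ₁ τ₂ : ℕ → ℝ} (ha₁ : Antitone τ₁) (ha₂ : Antitone τ₂)
    (hz₁ : τ₁ 0 = 1) (hz₂ : τ₂ 0 = 1) (hn₁ : ∀ s, 0 ≤ τ₁ s) (hn₂ : ∀ s, 0 ≤ τ₂ s) {κ p : ℝ}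
    (h1 : κ ≤ 2 * (1 - τ₁ 1)) (h2 : κ ≤ 2 * (τ₁ 1 - τ₁ 2)) (hp : 0 ≤ p) (hpκ : 2 * p ≤ κ) (n : ℕ) :
    ∃ G : ℕ → ℝ, (∀ j, |G j| ≤ 1) ∧ G 1 - G 0 = -(2 * p) ∧
      ∀ j, G (j + 2) - G (j + 1) =
        2 * (-1) ^ j * (if j ≤ n then τ₁ (n - j) else τ₂ (j - n)) := by
  set γ : ℕ → ℝ := fun j => if j = 0 then 2 * p - reflectSeq τ₁ n else
    if j ≤ n + 1 then reflectSeq τ₁ (n + 1 - j) else reflectSeq τ₂ (j - n - 2) with hγ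
  have hsucc (j : ℕ) : γ (j + 1) =
      if j ≤ n then reflectSeq τ₁ (n - j) else reflectSeq τ₂ (j - n - 1) := by
    have e1 : n + 1 - (j + 1) = n - j := by omega
    have e2 : j + 1 - n - 2 = j - n - 1 := by omega
    simp [hγ, e1, e2]
  refine ⟨fun j => (-1) ^ j * γ j, fun j => ?_, ?_, fun j => ?_⟩
  · rw [abs_mul, abs_pow, abs_neg, abs_one, one_pow, one_mul]
    rcases j with _ | j
    · have h3 := le_reflectSeq ha₁ hn₁ h1 h2 n
      have h4 := reflectSeq_mem ha₁ hz₁ n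
      simp only [hγ, if_true]
      rw [abs_le]
      constructor <;> linarith
    · rw [hsucc]
      split_ifs
      · exact abs_reflectSeq_le ha₁ hz₁ hn₁ _
      · exact abs_reflectSeq_le ha₂ hz₂ hn₂ _
  · simp [hγ]
    ring
  · have h3 : γ (j + 2) + γ (j + 1) = 2 * (if j ≤ n then τ₁ (n - j) else τ₂ (j - n)) := by
      rw [hsucc, hsucc]
      rcases lt_trichotomy j n with h | rfl | h
      · obtain ⟨d, rfl⟩ := Nat.exists_eq_add_of_lt h
        have e1 : j + d + 1 - (j + 1) = d := by omega
        have e2 : j + d + 1 - j = d + 1 := by omega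
        rw [if_pos (by omega), if_pos (by omega), if_pos (by omega), e1, e2, reflectSeq]
        ring
      · simp [reflectSeq, hz₁]
        norm_num
      · obtain ⟨d, rfl⟩ := Nat.exists_eq_add_of_lt h
        have e1 : n + d + 1 + 1 - n - 1 = d + 1 := by omega
        have e2 : n + d + 1 - n - 1 = d := by omega
        have e3 : n + d + 1 - n = d + 1 := by omega
        rw [if_neg (by omega), if_neg (by omega), if_neg (by omega), e1, e2, e3, reflectSeq]
        ring
    linear_combination (-1) ^ j * h3

/-- The correlation of the residual with the shifted kernel, as a function of the shift. -/
def correlation (q : ℝ) (s : ℤ) : ℝ :=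
  ∑ i ∈ Finset.range 6, kernelCoef i * q ^ (s + i + 1) * profile (s + i - 1)

lemma kernelCoef_nonneg (i : ℕ) : 0 ≤ kernelCoef i := by
  rw [kernelCoef]
  split_ifs <;> norm_num

lemma correlation_nonneg {q : ℝ} (hq : 0 < q) (s : ℤ) : 0 ≤ correlation q s :=
  Finset.sum_nonneg fun i _ =>
    mul_nonneg (mul_nonneg (kernelCoef_nonneg i) (zpow_nonneg hq.le _)) (profile_nonneg _)

lemma correlation_eq (q : ℝ) (s : ℤ) : correlation q s =
    1 / 11 * (q ^ (s + 1) * profile (s - 1)) + 2 / 11 * (q ^ (s + 2) * profile s +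
      q ^ (s + 3) * profile (s + 1) + q ^ (s + 4) * profile (s + 2) +
      q ^ (s + 5) * profile (s + 3) + q ^ (s + 6) * profile (s + 4)) := by
  simp only [correlation, Finset.sum_range_succ, Finset.sum_range_zero, kernelCoef]
  norm_num [add_assoc]
  ring_nf

lemma profile_values : profile (-5) = 0 ∧ profile (-4) = 0 ∧ profile (-3) = 0 ∧ profile (-2) = 0 ∧
    profile (-1) = 0 ∧ profile 0 = 1 / 11 ∧ profile 1 = 3 / 11 ∧ profile 2 = 5 / 11 ∧
    profile 3 = 7 / 11 ∧ profile 4 = 9 / 11 ∧ profile 5 = 1 ∧ profile 6 = 1 := by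
  norm_num [profile]

lemma correlation_values (q : ℝ) :
    correlation q 0 = (2 * q ^ 2 + 6 * q ^ 3 + 10 * q ^ 4 + 14 * q ^ 5 + 18 * q ^ 6) / 121 ∧
    correlation q 1 =
      (q ^ 2 + 6 * q ^ 3 + 10 * q ^ 4 + 14 * q ^ 5 + 18 * q ^ 6 + 22 * q ^ 7) / 121 ∧
    correlation q 2 =
      (3 * q ^ 3 + 10 * q ^ 4 + 14 * q ^ 5 + 18 * q ^ 6 + 22 * q ^ 7 + 22 * q ^ 8) / 121 ∧
    correlation q (-1) = (2 * q ^ 2 + 6 * q ^ 3 + 10 * q ^ 4 + 14 * q ^ 5) / 121 ∧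
    correlation q (-2) = (2 * q ^ 2 + 6 * q ^ 3 + 10 * q ^ 4) / 121 ∧
    correlation q (-3) = (2 * q ^ 2 + 6 * q ^ 3) / 121 ∧
    correlation q (-4) = 2 * q ^ 2 / 121 := by
  obtain ⟨h1, h2, h3, h4, h5, h6, h7, h8, h9, h10, h11, h12⟩ := profile_values
  have e (n : ℕ) [n.AtLeastTwo] : q ^ (OfNat.ofNat n : ℤ) = q ^ (OfNat.ofNat n : ℕ) := by
    rw [← zpow_natCast]; rfl
  simp only [correlation_eq]
  norm_num [h1, h2, h3, h4, h5, h6, h7, h8, h9, h10, h11, h12, e]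
  refine ⟨?_, ?_, ?_, ?_, ?_, ?_, ?_⟩ <;> ring

lemma correlation_of_le {q : ℝ} {s : ℤ} (hs : s ≤ -5) : correlation q s = 0 := by
  rw [correlation]
  refine Finset.sum_eq_zero fun i hi => ?_
  have := Finset.mem_range.1 hi
  rw [profile_of_neg (by omega), mul_zero]

lemma profile_succ_le_two_mul {l : ℤ} (h : 1 ≤ l) : profile (l + 1) ≤ 2 * profile l := by
  rcases le_or_gt 5 l with h5 | h5
  · rw [profile_of_ge h5]
    linarith [profile_le_one (l + 1)]
  · have h1 : (1 : ℝ) ≤ l := by exact_mod_cast h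
    rw [profile_of_nonneg_of_le (by omega) (by omega),
      profile_of_nonneg_of_le (by omega) (by omega)]
    push_cast
    linarith

lemma antitone_correlation {q : ℝ} (hq : 0 < q) (hq2 : q ≤ 1 / 2) :
    Antitone fun s : ℕ => correlation q s := by
  obtain ⟨h0, h1, h2, -⟩ := correlation_values q
  refine antitone_nat_of_succ_le fun s => ?_
  have hq5 : q ^ 5 ≤ 1 / 32 := by
    calc q ^ 5 ≤ (1 / 2) ^ 5 := by gcongr
      _ = _ := by norm_num
  rcases s with _ | _ | s
  · have e : ((0 + 1 : ℕ) : ℤ) = 1 := rfl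
    have e0 : ((0 : ℕ) : ℤ) = 0 := rfl
    rw [e, e0, h0, h1]
    have : q ^ 7 ≤ 1 / 32 * q ^ 2 := by
      calc q ^ 7 = q ^ 5 * q ^ 2 := by ring
        _ ≤ _ := by gcongr
    have : 0 < q ^ 2 := by positivity
    linarith
  · have e : ((0 + 1 + 1 : ℕ) : ℤ) = 2 := rfl
    have e0 : ((0 + 1 : ℕ) : ℤ) = 1 := rfl
    rw [e, e0, h2, h1]
    have : q ^ 8 ≤ 1 / 32 * q ^ 3 := by
      calc q ^ 8 = q ^ 5 * q ^ 3 := by ring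
        _ ≤ _ := by gcongr
    have : 0 < q ^ 2 := by positivity
    have : 0 < q ^ 3 := by positivity
    linarith
  · refine Finset.sum_le_sum fun i _ => ?_
    rw [mul_assoc, mul_assoc]
    refine mul_le_mul_of_nonneg_left ?_ (kernelCoef_nonneg i)
    have e : ((s + 1 + 1 + 1 : ℕ) : ℤ) + i + 1 = ((s + 1 + 1 : ℕ) : ℤ) + i + 1 + 1 := by
      push_cast; ring
    have e' : ((s + 1 + 1 + 1 : ℕ) : ℤ) + i - 1 = ((s + 1 + 1 : ℕ) : ℤ) + i - 1 + 1 := by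
      push_cast; ring
    rw [e, e', zpow_add_one₀ hq.ne']
    have h3 := profile_succ_le_two_mul (l := ((s + 1 + 1 : ℕ) : ℤ) + i - 1) (by omega)
    have h4 := profile_nonneg (((s + 1 + 1 : ℕ) : ℤ) + i - 1 + 1)
    rw [mul_assoc]
    refine mul_le_mul_of_nonneg_left ?_ (zpow_nonneg hq.le _)
    nlinarith

lemma antitone_correlation_neg {q : ℝ} (hq : 0 < q) :
    Antitone fun s : ℕ => correlation q (-s) := by
  obtain ⟨h0, -, -, h1, h2, h3, h4⟩ := correlation_values q
  refine antitone_nat_of_succ_le fun s => ?_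
  rcases s with _ | _ | _ | _ | _ | s
  · simp only [zero_add, Nat.cast_one, Nat.cast_zero, neg_zero, h0, h1]
    linarith [pow_pos hq 6]
  · simp only [Nat.reduceAdd, Nat.cast_ofNat, zero_add, Nat.cast_one, h2, h1]
    linarith [pow_pos hq 5]
  · simp only [Nat.reduceAdd, Nat.cast_ofNat, zero_add, h2, h3]
    linarith [pow_pos hq 4]
  · simp only [Nat.reduceAdd, Nat.cast_ofNat, zero_add, h4, h3]
    linarith [pow_pos hq 3]
  · rw [correlation_of_le (by simp)]
    exact correlation_nonneg hq _
  · rw [correlation_of_le (by push_cast; omega)]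
    exact correlation_nonneg hq _

lemma LamSpec.pow_mul_inner_residual_apply_uL (hb : b ≠ 0) (hc : 0 < c0) (hM : 2 ≤ M)
    (hΛ : LamSpec c0 M (2 / 11) b 5 Λ) (n j : ℕ) :
    M ^ n * ⟪Λ (ef 0) - Λ (∑ i ∈ Finset.range (n + 1), uL b i), Λ (uL b j)⟫ =
      c0 * correlation M⁻¹ (j - n) := by
  have hM0 : M ≠ 0 := by linarith
  rw [hΛ.apply_uL hb j, correlation, inner_sum, Finset.mul_sum, Finset.mul_sum]
  refine Finset.sum_congr rfl fun i _ => ?_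
  rw [real_inner_smul_right, real_inner_comm, hΛ.inner_ef_residual hb hc hM]
  have e1 : ((j + i : ℕ) : ℤ) - (n + 1 : ℕ) = j - n + i - 1 := by push_cast; ring
  have e2 : M⁻¹ ^ ((j : ℤ) - n + i + 1) = M ^ n / M ^ (j + i + 1) := by
    rw [inv_zpow', ← zpow_natCast, ← zpow_natCast, ← zpow_sub₀ hM0]
    congr 1
    push_cast
    ring
  rw [e1, e2]
  calc _ = kernelCoef i * M ^ n * eta c0 M (j + i + 1) ^ 2 * profile (j - n + i - 1) := by ring
    _ = _ := by
      rw [eta_sq hc.le (by linarith)]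
      ring

lemma LamSpec.pow_mul_inner_residual_apply_ef_zero (hb : b ≠ 0) (hc : 0 < c0) (hM : 2 ≤ M)
    (hΛ : LamSpec c0 M (2 / 11) b 5 Λ) (n : ℕ) :
    0 ≤ M ^ n * ⟪Λ (ef 0) - Λ (∑ i ∈ Finset.range (n + 1), uL b i), Λ (ef 0)⟫ ∧
      M ^ n * ⟪Λ (ef 0) - Λ (∑ i ∈ Finset.range (n + 1), uL b i), Λ (ef 0)⟫ ≤ c0 / 2 := by
  have hM0 : 0 < M := by linarith
  set r := Λ (ef 0) - Λ (∑ i ∈ Finset.range (n + 1), uL b i) with hr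
  have h := ((hΛ.hasSum_apply_ef_zero hc hM).mapL (innerSL ℝ r)).mul_left (M ^ n)
  simp only [innerSL_apply_apply, real_inner_smul_right] at h
  have hterm (m : ℕ) : M ^ n * (profile m * eta c0 M (m + 1) * ⟪r, ef m⟫) =
      M ^ n * (c0 / M ^ (m + 1)) * (profile m * profile (m - (n + 1 : ℕ))) := by
    rw [real_inner_comm, hr, hΛ.inner_ef_residual hb hc hM, ← eta_sq hc.le hM0]
    ring
  simp only [hterm] at h
  refine ⟨h.nonneg fun m => mul_nonneg (by positivity)
    (mul_nonneg (profile_nonneg _) (profile_nonneg _)), ?_⟩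
  have h2 := (hasSum_nat_add_iff' (n + 1)).2 h
  rw [Finset.sum_eq_zero, sub_zero] at h2
  swap
  · intro m hm
    have := Finset.mem_range.1 hm
    rw [profile_of_neg (l := (m : ℤ) - (n + 1 : ℕ)) (by omega), mul_zero, mul_zero]
  have hq : M⁻¹ ≤ 1 / 2 := by
    rw [inv_le_comm₀ hM0 (by norm_num)]
    linarith
  have hq0 : 0 < M⁻¹ := by positivity
  have h3 := (hasSum_geometric_of_lt_one hq0.le (by linarith)).mul_left (c0 * M⁻¹ ^ 2)
  refine (hasSum_le (fun m => ?_) h2 h3).trans ?_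
  · calc _ ≤ M ^ n * (c0 / M ^ (m + (n + 1) + 1)) * 1 := by
          refine mul_le_mul_of_nonneg_left ?_ (by positivity)
          exact mul_le_one₀ (profile_le_one _) (profile_nonneg _) (profile_le_one _)
      _ = _ := by
          rw [inv_pow, inv_pow]
          field_simp
          ring
  · rw [← div_eq_mul_inv, div_le_iff₀ (by linarith)]
    have h4 : M⁻¹ ^ 2 ≤ 1 / 2 * (1 - M⁻¹) := by nlinarith
    linarith [mul_le_mul_of_nonneg_left h4 hc.le]

lemma LamSpec.inner_residual_eq_zero (hb : b ≠ 0) (hc : 0 < c0) (hM : 2 ≤ M)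
    (hΛ : LamSpec c0 M (2 / 11) b 5 Λ) (n : ℕ) {d : Lp ℝ 2 (volume : Measure ℝ)}
    (hd : ∀ m, ⟪ef m, d⟫ = 0) :
    ⟪Λ (ef 0) - Λ (∑ i ∈ Finset.range n, uL b i), d⟫ = 0 := by
  rw [inner_sub_left, map_sum, sum_inner, Finset.sum_eq_zero, sub_zero]
  · have h := (hΛ.hasSum_apply_ef_zero hc hM).mapL (innerSL ℝ d)
    have hd' (m : ℕ) : ⟪d, ef m⟫ = 0 := by rw [real_inner_comm, hd]
    simp only [innerSL_apply_apply, real_inner_smul_right, hd', mul_zero] at h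
    rw [real_inner_comm]
    exact h.unique hasSum_zero
  · intro j _
    rw [hΛ.apply_uL hb, sum_inner]
    simp [real_inner_smul_left, hd]

lemma ef_succ_eq (hb : b ≠ 0) (j : ℕ) : ef (j + 1) = (√((j : ℝ) + 2) / b) • uL b j := by
  have h : √((j : ℝ) + 2) ≠ 0 := by positivity
  rw [uL, smul_smul, div_mul_div_cancel₀ hb, div_self h, one_smul]

/-- `2 λ_n Λ^* r_{n+1}` belongs to the dual unit ball of `BVnorm`. -/
lemma LamSpec.ofReal_inner_residual_le_BVnorm {α0 κ : ℝ} (hα : 0 < α0) (hM : 2 ≤ M) (hc : 0 < c0)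
    (hb : b = 2 * α0 * c0 * correlation M⁻¹ 0)
    (hκ₁ : κ ≤ 2 * (1 - correlation M⁻¹ (-1) / correlation M⁻¹ 0))
    (hκ₂ : κ ≤ 2 * (correlation M⁻¹ (-1) / correlation M⁻¹ 0 -
      correlation M⁻¹ (-2) / correlation M⁻¹ 0))
    (hκ : 2 * α0 * c0 ≤ κ) (hX : 0 < correlation M⁻¹ 0)
    (hΛ : LamSpec c0 M (2 / 11) b 5 Λ) (n : ℕ) (w : Lp ℝ 2 (volume : Measure ℝ)) :
    ENNReal.ofReal (2 * α0 * (M ^ n *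
      ⟪Λ (ef 0) - Λ (∑ i ∈ Finset.range (n + 1), uL b i), Λ w⟫)) ≤ BVnorm w := by
  have hM0 : 0 < M := by linarith
  have hq : M⁻¹ ≤ 1 / 2 := by
    rw [inv_le_comm₀ hM0 (by norm_num)]
    linarith
  have hq0 : 0 < M⁻¹ := by positivity
  have hb0 : 0 < b := by rw [hb]; positivity
  set r := Λ (ef 0) - Λ (∑ i ∈ Finset.range (n + 1), uL b i) with hr
  obtain ⟨hp0, hp1⟩ := hΛ.pow_mul_inner_residual_apply_ef_zero hb0.ne' hc hM n
  rw [← hr] at hp0 hp1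
  obtain ⟨G, hG, hG0, hGs⟩ := exists_calibration
    (τ₁ := fun s : ℕ => correlation M⁻¹ (-s) / correlation M⁻¹ 0)
    (τ₂ := fun s : ℕ => correlation M⁻¹ s / correlation M⁻¹ 0)
    (fun s t hst => div_le_div_of_nonneg_right (antitone_correlation_neg hq0 hst) hX.le)
    (fun s t hst => div_le_div_of_nonneg_right (antitone_correlation hq0 hq hst) hX.le)
    (by simp [hX.ne']) (by simp [hX.ne'])
    (fun s => div_nonneg (correlation_nonneg hq0 _) hX.le)
    (fun s => div_nonneg (correlation_nonneg hq0 _) hX.le)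
    (κ := κ) (p := 2 * α0 * (M ^ n * ⟪r, Λ (ef 0)⟫)) (by simpa using hκ₁) (by simpa using hκ₂)
    (by positivity) (by nlinarith) n
  have hcorr (j : ℕ) : (if j ≤ n then correlation M⁻¹ (-((n - j : ℕ) : ℤ)) / correlation M⁻¹ 0
      else correlation M⁻¹ ((j - n : ℕ) : ℤ) / correlation M⁻¹ 0) =
      correlation M⁻¹ (j - n) / correlation M⁻¹ 0 := by
    split_ifs with h
    · rw [Nat.cast_sub h, neg_sub]
    · rw [Nat.cast_sub (by omega)]
  simp only [hcorr] at hGs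
  obtain ⟨h, hsum, horth⟩ := exists_hasSum_ef w
  have hw : ⟪r, Λ w⟫ = ⟪r, Λ h⟫ := by
    have h1 : Λ w = Λ h + (w - h) := by
      rw [← hΛ.apply_eq_self horth, ← map_add, add_sub_cancel]
    rw [h1, inner_add_right, hr, hΛ.inner_residual_eq_zero hb0.ne' hc hM _ horth, add_zero]
  have hs := (((hsum.mapL Λ).mapL (innerSL ℝ r)).mul_left (M ^ n)).mul_left (2 * α0)
  simp only [map_smul, innerSL_apply_apply, smul_eq_mul, ← hw] at hs
  have hterm (j : ℕ) : 2 * α0 * (M ^ n * (⟪ef j, w⟫ * ⟪r, Λ (ef j)⟫)) =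
      (G (j + 1) - G j) * intervalMean j w := by
    rcases j with _ | j
    · rw [zero_add, hG0, intervalMean_eq_inner]
      simp
      ring
    · have e : ((j + 1 : ℕ) : ℝ) + 1 = j + 2 := by push_cast; ring
      have h1 : ((-1 : ℝ) ^ j) * (-1) ^ j = 1 := by
        rw [← mul_pow]; simp
      have h2 : M ^ n * ⟪r, Λ (ef (j + 1))⟫ =
          √((j : ℝ) + 2) / b * (c0 * correlation M⁻¹ (j - n)) := by
        rw [ef_succ_eq hb0.ne', map_smul, real_inner_smul_right,
          ← hΛ.pow_mul_inner_residual_apply_uL hb0.ne' hc hM n j]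
        ring
      have h3 : 2 * α0 * (√((j : ℝ) + 2) / b * (c0 * correlation M⁻¹ (j - n))) =
          √((j : ℝ) + 2) * (correlation M⁻¹ (j - n) / correlation M⁻¹ 0) := by
        rw [hb]
        field_simp
      rw [hGs j, intervalMean_eq_inner, e]
      linear_combination 2 * α0 * ⟪ef (j + 1), w⟫ * h2 + ⟪ef (j + 1), w⟫ * h3 -
        (correlation M⁻¹ (j - n) / correlation M⁻¹ 0) * √((j : ℝ) + 2) * ⟪ef (j + 1), w⟫ * h1
  simp only [hterm] at hs
  exact le_of_tendsto (ENNReal.tendsto_ofReal hs.tendsto_sum_nat)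
    (Eventually.of_forall fun N => ofReal_sum_intervalMean_le_BVnorm w hG N)

lemma LamSpec.eq_zero_of_apply_eq_zero (hb : b ≠ 0) (hc : 0 < c0) (hM : 2 ≤ M)
    (hΛ : LamSpec c0 M (2 / 11) b 5 Λ) {d : Lp ℝ 2 (volume : Measure ℝ)} (hd : Λ d = 0) :
    d = 0 := by
  obtain ⟨h, hsum, horth⟩ := exists_hasSum_ef d
  have hh : Λ h = -(d - h) := by
    rw [← hΛ.apply_eq_self horth, map_sub, hd]
    simp
  set x : ℕ → ℝ := fun j => ⟪ef j, d⟫ with hx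
  set z : ℕ → ℝ := fun j => x (j + 1) * (√((j : ℝ) + 2) / b) + x 0 with hz
  have happ (m j : ℕ) : ⟪ef m, Λ (ef (j + 1))⟫ =
      √((j : ℝ) + 2) / b * (eta c0 M (m + 1) * (profile (m - j) - profile (m - j - 1))) := by
    rw [ef_succ_eq hb, map_smul, real_inner_smul_right, hΛ.inner_ef_apply_uL hb]
  have hconv (m : ℕ) :
      ∑ j ∈ Finset.range (m + 1), z j * (profile (m - j) - profile (m - j - 1)) = 0 := by
    have h1 := (hsum.mapL Λ).mapL (innerSL ℝ (ef m))
    simp only [map_smul, innerSL_apply_apply, smul_eq_mul] at h1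
    rw [hh, inner_neg_right, horth, neg_zero] at h1
    have h2 := h1.unique (hasSum_sum_of_ne_finset_zero (s := Finset.range (m + 1 + 1))
      fun j hj => by
        obtain ⟨i, rfl⟩ := Nat.exists_eq_add_of_le' (by simp at hj; omega : 1 ≤ j)
        simp only [Finset.mem_range, not_lt] at hj
        rw [happ, profile_of_neg (by omega), profile_of_neg (by omega)]
        ring)
    rw [Finset.sum_range_succ', hΛ.inner_ef_apply_ef_zero hc hM] at h2
    have h3 : ∑ j ∈ Finset.range (m + 1), (profile (m - j) - profile (m - j - 1)) = profile m := by
      have := Finset.sum_range_sub' (fun j : ℕ => profile (m - j)) (m + 1)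
      simp only [Nat.cast_zero, sub_zero] at this
      rw [profile_of_neg (l := (m : ℤ) - (m + 1 : ℕ)) (by omega), sub_zero] at this
      rw [← this]
      refine Finset.sum_congr rfl fun j _ => ?_
      push_cast
      rw [sub_sub]
    have h4 : eta c0 M (m + 1) *
        ∑ j ∈ Finset.range (m + 1), z j * (profile (m - j) - profile (m - j - 1)) = 0 := by
      rw [h2]
      simp only [hz, add_mul, Finset.sum_add_distrib]
      rw [← Finset.mul_sum, h3, mul_add, Finset.mul_sum]
      congr 1
      · refine Finset.sum_congr rfl fun j _ => ?_
        rw [happ]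
        ring
      · ring
    exact (mul_eq_zero.1 h4).resolve_left (eta_pos hc (by linarith) _).ne'
  have hz0 (m : ℕ) : z m = 0 := by
    induction m using Nat.strong_induction_on with
    | _ m ih =>
      have h1 := hconv m
      rw [Finset.sum_range_succ, Finset.sum_eq_zero, zero_add, sub_self,
        profile_of_neg (l := 0 - 1) (by norm_num),
        profile_of_nonneg_of_le le_rfl (by norm_num)] at h1
      · norm_num at h1
        exact h1
      · intro j hj
        rw [ih j (Finset.mem_range.1 hj), zero_mul]
  have hxs (j : ℕ) : x (j + 1) ^ 2 = (b * x 0) ^ 2 * (1 / ((j : ℝ) + 2)) := by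
    have h1 : √((j : ℝ) + 2) ^ 2 = j + 2 := Real.sq_sqrt (by positivity)
    have h2 : x (j + 1) * √((j : ℝ) + 2) = -(b * x 0) := by
      have h3 := hz0 j
      simp only [hz] at h3
      field_simp at h3
      linarith
    rw [mul_one_div, eq_div_iff (by positivity), ← h1, ← mul_pow, h2, neg_sq]
  have hx0 : x 0 = 0 := by
    by_contra hne
    have h1 : Summable fun j => x (j + 1) ^ 2 := by
      have := (summable_nat_add_iff 1).2 (orthonormal_ef.inner_products_summable d)
      simpa [hx] using this
    simp only [hxs] at h1
    rw [summable_mul_left_iff (by positivity)] at h1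
    exact not_tendsto_nhds_of_tendsto_atTop tendsto_sum_one_div_add_two _ h1.hasSum.tendsto_sum_nat
  have hx1 (m : ℕ) : ⟪ef m, d⟫ = 0 := by
    rcases m with _ | m
    · exact hx0
    · have := hxs m
      rw [hx0, mul_zero, zero_pow two_ne_zero, zero_mul] at this
      exact pow_eq_zero_iff two_ne_zero |>.1 this
  rw [← hΛ.apply_eq_self hx1, hd]

/-- The step functional exceeds its value at `u` by at least the energy of `Λ (w - u)`, as soon
as `2 λ Λ^* r` is a subgradient of `BVnorm` at `u`. -/
lemma ofReal_add_le_JL {α0 : ℝ} {n : ℕ}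
    (hu : 2 * α0 * (M ^ n *
      ⟪Λ (ef 0) - Λ (∑ i ∈ Finset.range (n + 1), uL b i), Λ (uL b n)⟫) = b)
    {w : Lp ℝ 2 (volume : Measure ℝ)}
    (hw : ENNReal.ofReal (2 * α0 * (M ^ n *
      ⟪Λ (ef 0) - Λ (∑ i ∈ Finset.range (n + 1), uL b i), Λ w⟫)) ≤ BVnorm w) :
    ENNReal.ofReal (α0 * M ^ n * ‖Λ (ef 0) - Λ (∑ i ∈ Finset.range (n + 1), uL b i)‖ ^ 2 + b +
      α0 * M ^ n * ‖Λ (w - uL b n)‖ ^ 2) ≤ JL α0 M b Λ n w := by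
  set r := Λ (ef 0) - Λ (∑ i ∈ Finset.range (n + 1), uL b i) with hr
  have e : Λ (ef 0) - Λ ((∑ j ∈ Finset.range n, uL b j) + w) = r - Λ (w - uL b n) := by
    rw [hr, Finset.sum_range_succ]
    simp only [map_add, map_sub]
    abel
  rw [JL, e]
  refine le_trans (le_trans (ENNReal.ofReal_le_ofReal ?_) ENNReal.ofReal_add_le)
    (add_le_add_right hw _)
  rw [norm_sub_sq_real r, map_sub, inner_sub_right]
  linear_combination -hu

/-- The value of the step functional at `u_n` is at most the energy of the next residual
plus `b`. -/
lemma JL_uL_le {α0 : ℝ} (hα : 0 < α0) (hM : 0 < M) (hb : 0 < b) (n : ℕ) :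
    JL α0 M b Λ n (uL b n) ≤ ENNReal.ofReal
      (α0 * M ^ n * ‖Λ (ef 0) - Λ (∑ i ∈ Finset.range (n + 1), uL b i)‖ ^ 2 + b) := by
  rw [JL, ← Finset.sum_range_succ, ENNReal.ofReal_add (by positivity) hb.le]
  exact add_le_add_right (BVnorm_uL_le hb n) _

/-- Theorem 4.12: a non-converging multiscale decomposition for a
bounded linear blurring operator on the line.  For every `M ≥ 2`, `α₀ > 0` and `k = 5`
there are `c₀, b > 0` and `0 < δ < 1/k` such that, for `Λ̃ = Λ e₁`, the multiscale
sequence coincides with `σ_n = ∑_{j=0}^n u_j`, `u_j = (b/√(j+2)) e_{j+2}`: each `u_n`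
is the unique minimizer of the `n`-th step functional.  In particular
`‖σ_n‖_{L²} → +∞`, `‖σ_n‖_{L¹} → +∞` and `‖σ_n‖_{BV(ℝ)} = b(n+1) → +∞`. -/
theorem statement19 (M α0 : ℝ) (hM : 2 ≤ M) (hα0 : 0 < α0) (k : ℕ) (hk : k = 5) :
    ∃ c0 b δ : ℝ, 0 < c0 ∧ 0 < b ∧ 0 < δ ∧ δ < 1 / k ∧
      ∀ Λ : Lp ℝ 2 (volume : Measure ℝ) →L[ℝ] Lp ℝ 2 (volume : Measure ℝ),
        LamSpec c0 M δ b k Λ →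
        (∀ n : ℕ,
          (∀ w : Lp ℝ 2 (volume : Measure ℝ), JL α0 M b Λ n (uL b n) ≤ JL α0 M b Λ n w) ∧
          (∀ w : Lp ℝ 2 (volume : Measure ℝ),
            (∀ w' : Lp ℝ 2 (volume : Measure ℝ), JL α0 M b Λ n w ≤ JL α0 M b Λ n w') →
            w = uL b n)) ∧
        Tendsto (fun n : ℕ => ‖∑ j ∈ Finset.range (n + 1), uL b j‖) atTop atTop ∧
        Tendsto (fun n : ℕ => eLpNorm (⇑(∑ j ∈ Finset.range (n + 1), uL b j)) 1 volume)
          atTop (𝓝 ⊤) ∧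
        (∀ n : ℕ, BVnorm (∑ j ∈ Finset.range (n + 1), uL b j) =
          ENNReal.ofReal (b * ((n : ℝ) + 1))) := by
  subst hk
  have hM0 : 0 < M := by linarith
  have hq0 : 0 < M⁻¹ := by positivity
  obtain ⟨h0, -, -, h1, h2, -⟩ := correlation_values M⁻¹
  have hX : 0 < correlation M⁻¹ 0 := by
    rw [h0]
    positivity
  set κ := min (2 * (1 - correlation M⁻¹ (-1) / correlation M⁻¹ 0))
    (2 * (correlation M⁻¹ (-1) / correlation M⁻¹ 0 - correlation M⁻¹ (-2) / correlation M⁻¹ 0))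
    with hκ
  have hκ0 : 0 < κ := by
    have h3 : correlation M⁻¹ (-1) / correlation M⁻¹ 0 < 1 := by
      rw [div_lt_one hX, h0, h1]
      linarith [pow_pos hq0 6]
    have h4 : correlation M⁻¹ (-2) / correlation M⁻¹ 0 <
        correlation M⁻¹ (-1) / correlation M⁻¹ 0 := by
      refine div_lt_div_of_pos_right ?_ hX
      rw [h1, h2]
      linarith [pow_pos hq0 5]
    exact lt_min (by linarith) (by linarith)
  obtain ⟨c0, hc, hcκ⟩ : ∃ c0 : ℝ, 0 < c0 ∧ 2 * α0 * c0 = κ :=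
    ⟨κ / (2 * α0), by positivity, by field_simp⟩
  obtain ⟨b, hb⟩ : ∃ b, b = 2 * α0 * c0 * correlation M⁻¹ 0 := ⟨_, rfl⟩
  have hb0 : 0 < b := by
    rw [hb]
    positivity
  refine ⟨c0, b, 2 / 11, hc, hb0, by norm_num, by norm_num, fun Λ hΛ => ⟨fun n => ?_,
    (tendsto_norm_sum_uL hb0).comp (tendsto_add_atTop_nat 1),
    (tendsto_eLpNorm_one_sum_uL hb0).comp (tendsto_add_atTop_nat 1), fun n => ?_⟩⟩
  · have hu : 2 * α0 * (M ^ n *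
        ⟪Λ (ef 0) - Λ (∑ i ∈ Finset.range (n + 1), uL b i), Λ (uL b n)⟫) = b := by
      rw [hΛ.pow_mul_inner_residual_apply_uL hb0.ne' hc hM, sub_self, hb]
      ring
    have hlow (w : Lp ℝ 2 (volume : Measure ℝ)) := ofReal_add_le_JL hu
      (hΛ.ofReal_inner_residual_le_BVnorm hα0 hM hc hb (min_le_left _ _) (min_le_right _ _)
        hcκ.le hX n w)
    have hup := JL_uL_le (Λ := Λ) hα0 hM0 hb0 n
    refine ⟨fun w => hup.trans (le_trans (ENNReal.ofReal_le_ofReal ?_) (hlow w)), fun w hw => ?_⟩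
    · exact le_add_of_nonneg_right (by positivity)
    · have h3 := (hlow w).trans ((hw (uL b n)).trans hup)
      rw [ENNReal.ofReal_le_ofReal_iff (by positivity)] at h3
      have h4 : α0 * M ^ n * ‖Λ (w - uL b n)‖ ^ 2 = 0 :=
        le_antisymm (by linarith) (by positivity)
      have h5 : Λ (w - uL b n) = 0 := by
        have : α0 * M ^ n ≠ 0 := by positivity
        simpa [this, hα0.ne', hM0.ne'] using h4
      exact sub_eq_zero.1 (hΛ.eq_zero_of_apply_eq_zero hb0.ne' hc hM h5)
  · rw [BVnorm_sum_uL hb0 (n + 1)]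
    push_cast
    rfl
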